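/- Let F be a differential field of characteristic zero with field of constants C, let f₁, f₂ ∈ F satisfy condition (C), and let r ∈ F. Let F ⊆ E be an extension of differential fields with E = F(x₁, x₂, y) for elements x₁, x₂, y ∈ E which are algebraically independent over F and satisfy x₁′ = f₁, x₂′ = f₂, and y′ = f₁·x₂ + r. Then every constant of E lies in C. In particular, there is no element u ∈ F(x₁, x₂) with u′ = f₁·x₂ + r. -/

import Mathlib

open Polynomial IntermediateField Differential

section PrimitiveExtension

variable {K L : Type*} [Field K] [Field L] [Algebra K L]

/-- The derivation induced on a field `K` by a differential field extension `L` in which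
the image of `K` is stable under the derivation. -/
@[reducible]
noncomputable def Differential.restrict [Differential L]
    (h : ∀ a : K, ∃ b : K, algebraMap K L b = (algebraMap K L a)′) : Differential K where
  deriv := Derivation.mk'
    (AddMonoidHom.toIntLinearMap
      { toFun := fun a ↦ (h a).choose
        map_zero' := (algebraMap K L).injective ((h 0).choose_spec.trans (by simp))
        map_add' := fun a b ↦ (algebraMap K L).injective
          ((h (a + b)).choose_spec.trans (by simp [(h a).choose_spec, (h b).choose_spec])) })
    (fun a b ↦ (algebraMap K L).injective
      ((h (a * b)).choose_spec.trans (by simp [(h a).choose_spec, (h b).choose_spec])))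

theorem Differential.differentialAlgebra_restrict [Differential L]
    (h : ∀ a : K, ∃ b : K, algebraMap K L b = (algebraMap K L a)′) :
    letI := Differential.restrict h
    DifferentialAlgebra K L :=
  letI := Differential.restrict h
  ⟨fun a ↦ ((h a).choose_spec).symm⟩

variable [Differential K]

theorem Differential.coeff_implicitDeriv_C (a : K) (p : K[X]) (n : ℕ) :
    (implicitDeriv (C a) p).coeff n = (p.coeff n)′ + (n + 1) * p.coeff (n + 1) * a := by
  simp [implicitDeriv, coeff_derivative]
  ring

theorem Differential.eq_zero_of_deriv_add_mul_eq_zero {a : K} (ha : ∀ g : K, g′ ≠ a) {b c : K}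
    (hc : c′ = 0) (h : b′ + c * a = 0) : c = 0 := by
  by_contra hc0
  apply ha (-b * c⁻¹)
  simp only [Derivation.leibniz, Derivation.leibniz_inv, hc, smul_eq_mul, map_neg]
  field_simp
  linear_combination -c * h

theorem Differential.deriv_mem_adjoin [Differential L] [DifferentialAlgebra K L] {S : Set L}
    (hS : ∀ s ∈ S, s′ ∈ adjoin K S) {u : L} (hu : u ∈ adjoin K S) : u′ ∈ adjoin K S := by
  induction hu using adjoin_induction with
  | mem x hx => exact hS x hx
  | algebraMap x => rw [deriv_algebraMap]; exact IntermediateField.algebraMap_mem _ _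
  | add x y hx hy hx' hy' => rw [map_add]; exact add_mem hx' hy'
  | inv x hx hx' =>
    rw [Derivation.leibniz_inv]
    exact mul_mem (neg_mem (pow_mem (inv_mem hx) 2)) hx'
  | mul x y hx hy hx' hy' =>
    rw [Derivation.leibniz]
    exact add_mem (mul_mem hx hy') (mul_mem hy hx')

variable [CharZero K]

/-- A polynomial whose derivative has degree smaller by two than expected is constant. -/
theorem Differential.natDegree_eq_zero_of_implicitDeriv_coeff {a : K} (ha : ∀ g : K, g′ ≠ a)
    {p : K[X]} (h0 : (implicitDeriv (C a) p).coeff p.natDegree = 0)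
    (h1 : (implicitDeriv (C a) p).coeff (p.natDegree - 1) = 0) : p.natDegree = 0 := by
  by_contra hn
  obtain ⟨n, hn'⟩ := Nat.exists_eq_succ_of_ne_zero hn
  have hp : p.coeff (n + 1) ≠ 0 := by
    rw [← Nat.succ_eq_add_one, ← hn']
    exact leadingCoeff_ne_zero.2 (by rintro rfl; simp at hn)
  have hp' : p.coeff (n + 1 + 1) = 0 := coeff_eq_zero_of_natDegree_lt (by lia)
  rw [hn', coeff_implicitDeriv_C, Nat.succ_eq_add_one, hp'] at h0
  rw [hn', coeff_implicitDeriv_C, Nat.succ_eq_add_one, Nat.add_sub_cancel] at h1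
  have hc : (p.coeff (n + 1))′ = 0 := by simpa using h0
  have hcn : ((n + 1 : K) * p.coeff (n + 1))′ = 0 := by simp [hc]
  have := eq_zero_of_deriv_add_mul_eq_zero ha hcn h1
  exact mul_ne_zero (by exact_mod_cast n.succ_ne_zero) hp this

variable [Differential L] [DifferentialAlgebra K L] {t : L} {a : K}

/-- An element of `K(t)` whose derivative lies in `K[t]` lies itself in `K[t]`, provided `t` is a
transcendental primitive of an element of `K` which has no primitive in `K`. -/
theorem Differential.exists_aeval_eq_of_deriv_eq_aeval (ht : Transcendental K t)
    (hta : t′ = algebraMap K L a) (ha : ∀ g : K, g′ ≠ a) {u : L} (hu : u ∈ K⟮t⟯) {s : K[X]}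
    (hs : u′ = aeval t s) : ∃ p : K[X], u = aeval t p ∧ implicitDeriv (C a) p = s := by
  have hinj := transcendental_iff_injective.1 ht
  have hder : ∀ p : K[X], (aeval t p)′ = aeval t (implicitDeriv (C a) p) :=
    deriv_aeval_eq_implicitDeriv t (C a) (by simpa using hta)
  suffices ∃ p : K[X], u = aeval t p by
    obtain ⟨p, rfl⟩ := this
    exact ⟨p, rfl, hinj (by rw [← hder, hs])⟩
  obtain ⟨p, q, hq, hcop, hpq⟩ : ∃ p q : K[X], q.Monic ∧ IsCoprime q p ∧
      u * aeval t q = aeval t p := by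
    obtain ⟨p, q, rfl⟩ := (mem_adjoin_simple_iff K u).1 hu
    rcases eq_or_ne q 0 with rfl | hq
    · exact ⟨0, 1, monic_one, isCoprime_one_left, by simp⟩
    classical
    obtain ⟨p', q', hp, hq', hunit⟩ := extract_gcd p q
    generalize gcd p q = g at hp hq'
    subst hp hq'
    have hg := left_ne_zero_of_mul hq
    have hq0 := right_ne_zero_of_mul hq
    have hc : IsUnit (C q'.leadingCoeff⁻¹) :=
      isUnit_C.2 (IsUnit.mk0 _ (inv_ne_zero (leadingCoeff_ne_zero.2 hq0)))
    refine ⟨p' * C q'.leadingCoeff⁻¹, q' * C q'.leadingCoeff⁻¹,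
      monic_mul_leadingCoeff_inv hq0, ?_, ?_⟩
    · exact (isCoprime_mul_unit_right hc _ _).2 ((gcd_isUnit_iff _ _).1 hunit).symm
    · have hg' : aeval t g ≠ 0 := fun h ↦ hg (hinj (by simpa using h))
      have hq' : aeval t q' ≠ 0 := fun h ↦ hq0 (hinj (by simpa using h))
      simp only [map_mul]
      field_simp
  have hrel : s * q ^ 2 + p * implicitDeriv (C a) q = implicitDeriv (C a) p * q := by
    apply hinj
    have h := congrArg (fun z : L ↦ z′) hpq
    simp only [Derivation.leibniz, smul_eq_mul, hder, hs] at h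
    simp only [map_add, map_mul, map_pow, ← h, ← hpq]
    ring
  have hdvd : q ∣ implicitDeriv (C a) q := by
    refine hcop.dvd_of_dvd_mul_left ⟨implicitDeriv (C a) p - s * q, ?_⟩
    linear_combination hrel
  have hcoeff : (implicitDeriv (C a) q).degree < q.degree := by
    rw [degree_eq_natDegree hq.ne_zero, degree_lt_iff_coeff_zero]
    intro m hm
    rw [coeff_implicitDeriv_C, coeff_eq_zero_of_natDegree_lt (show q.natDegree < m + 1 by lia)]
    rcases hm.eq_or_lt with rfl | hm
    · simp [hq.coeff_natDegree]
    · simp [coeff_eq_zero_of_natDegree_lt hm]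
  have hq' : implicitDeriv (C a) q = 0 := eq_zero_of_dvd_of_degree_lt hdvd hcoeff
  have hq1 : q = 1 := hq.natDegree_eq_zero.1
    (natDegree_eq_zero_of_implicitDeriv_coeff ha (by simp [hq']) (by simp [hq']))
  exact ⟨p, by simpa [hq1] using hpq⟩

/-- An element of `K(t)` whose derivative lies in `K` is affine in `t`, with a constant slope. -/
theorem Differential.exists_eq_mul_add_of_deriv_eq_algebraMap (ht : Transcendental K t)
    (hta : t′ = algebraMap K L a) (ha : ∀ g : K, g′ ≠ a) {u : L} (hu : u ∈ K⟮t⟯) {b : K}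
    (hb : u′ = algebraMap K L b) :
    ∃ c g : K, c′ = 0 ∧ g′ + c * a = b ∧ u = algebraMap K L c * t + algebraMap K L g := by
  obtain ⟨p, rfl, hp⟩ := exists_aeval_eq_of_deriv_eq_aeval ht hta ha hu (s := C b) (by simpa)
  have hdeg : p.natDegree ≤ 1 := by
    by_contra! h
    have := natDegree_eq_zero_of_implicitDeriv_coeff ha (p := p)
      (by rw [hp, coeff_C_of_ne_zero (by lia)]) (by rw [hp, coeff_C_of_ne_zero (by lia)])
    lia
  have h0 := coeff_implicitDeriv_C a p 0
  have h1 := coeff_implicitDeriv_C a p 1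
  rw [hp] at h0 h1
  rw [coeff_eq_zero_of_natDegree_lt (show p.natDegree < 1 + 1 by lia)] at h1
  refine ⟨p.coeff 1, p.coeff 0, ?_, ?_, ?_⟩
  · simpa [coeff_C] using h1.symm
  · simpa using h0.symm
  · conv_lhs => rw [eq_X_add_C_of_natDegree_le_one hdeg]
    simp

theorem Differential.exists_algebraMap_eq_of_deriv_eq_zero (ht : Transcendental K t)
    (hta : t′ = algebraMap K L a) (ha : ∀ g : K, g′ ≠ a) {u : L} (hu : u ∈ K⟮t⟯)
    (h : u′ = 0) : ∃ c : K, c′ = 0 ∧ u = algebraMap K L c := by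
  obtain ⟨c, g, hc, hg, rfl⟩ :=
    exists_eq_mul_add_of_deriv_eq_algebraMap ht hta ha hu (b := 0) (by simpa)
  obtain rfl := eq_zero_of_deriv_add_mul_eq_zero ha hc hg
  exact ⟨g, by simpa using hg, by simp⟩

/-- If `f₁, f₂` satisfy condition (C) and `t′ = f₂`, then `f₁ t + r` has no primitive in `K(t)`. -/
theorem Differential.deriv_ne_mul_add_of_mem_adjoin {f₁ f₂ : K}
    (hC : ∀ c₁ c₂ g : K, c₁′ = 0 → c₂′ = 0 → c₁ * f₁ + c₂ * f₂ = g′ → c₁ = 0 ∧ c₂ = 0)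
    (ht : Transcendental K t) (hta : t′ = algebraMap K L f₂) (r : K) {u : L} (hu : u ∈ K⟮t⟯) :
    u′ ≠ algebraMap K L f₁ * t + algebraMap K L r := by
  intro h
  have ha : ∀ g : K, g′ ≠ f₂ := fun g hg ↦
    one_ne_zero (hC 0 1 g (by simp) (by simp) (by simp [hg])).2
  obtain ⟨p, rfl, hp⟩ := exists_aeval_eq_of_deriv_eq_aeval ht hta ha hu (s := C f₁ * X + C r)
    (by simpa)
  have hdeg : p.natDegree ≤ 2 := by
    by_contra! h
    have hz : ∀ n, 2 ≤ n → (implicitDeriv (C f₂) p).coeff n = 0 := fun n hn ↦ by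
      rw [hp]
      exact coeff_eq_zero_of_natDegree_lt (natDegree_linear_le.trans_lt (by lia))
    have := natDegree_eq_zero_of_implicitDeriv_coeff ha (hz _ (by lia)) (hz _ (by lia))
    lia
  have h1 := coeff_implicitDeriv_C f₂ p 1
  have h2 := coeff_implicitDeriv_C f₂ p 2
  rw [hp] at h1 h2
  rw [coeff_eq_zero_of_natDegree_lt (show p.natDegree < 2 + 1 by lia)] at h2
  have h2' : (p.coeff 2)′ = 0 := by simpa [coeff_X, coeff_C] using h2.symm
  have h1' : f₁ = (p.coeff 1)′ + (1 + 1) * p.coeff 2 * f₂ := by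
    simpa [coeff_X, coeff_C] using h1
  refine one_ne_zero (hC 1 (-(1 + 1) * p.coeff 2) (p.coeff 1) (by simp) (by simp [h2']) ?_).1
  linear_combination h1'

/-- The tower `K ⊆ K(x₂) ⊆ K(x₂, x₁)`: it has no new constants, and `f₁ x₂ + r` has no primitive
in it. -/
theorem Differential.constants_and_deriv_ne_of_mem_adjoin_pair {f₁ f₂ : K} {x₁ x₂ : L}
    (hC : ∀ c₁ c₂ g : K, c₁′ = 0 → c₂′ = 0 → c₁ * f₁ + c₂ * f₂ = g′ → c₁ = 0 ∧ c₂ = 0)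
    (ht₂ : Transcendental K x₂) (ht₁ : Transcendental K⟮x₂⟯ x₁)
    (h1 : x₁′ = algebraMap K L f₁) (h2 : x₂′ = algebraMap K L f₂) (r : K) {u : L}
    (hu : u ∈ K⟮x₂, x₁⟯) :
    (u′ = 0 → ∃ c : K, u = algebraMap K L c) ∧
      u′ ≠ algebraMap K L f₁ * x₂ + algebraMap K L r := by
  have hstable : ∀ a : K⟮x₂⟯, ∃ b : K⟮x₂⟯, algebraMap K⟮x₂⟯ L b = (algebraMap K⟮x₂⟯ L a)′ :=
    fun a ↦ ⟨⟨_, deriv_mem_adjoin (by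
      rintro _ rfl
      rw [h2]
      exact IntermediateField.algebraMap_mem _ _) a.2⟩, rfl⟩
  let := Differential.restrict hstable
  have := Differential.differentialAlgebra_restrict hstable
  have hcoe : ∀ a : K⟮x₂⟯, ((a′ : K⟮x₂⟯) : L) = (a : L)′ := fun a ↦ (deriv_algebraMap a).symm
  have ha : ∀ g : K, g′ ≠ f₂ := fun g hg ↦
    one_ne_zero (hC 0 1 g (by simp) (by simp) (by simp [hg])).2
  have h1' : x₁′ = algebraMap K⟮x₂⟯ L (algebraMap K K⟮x₂⟯ f₁) := h1
  have ha' : ∀ g : K⟮x₂⟯, g′ ≠ algebraMap K K⟮x₂⟯ f₁ := by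
    intro g hg
    have hg' : (g : L)′ = algebraMap K L f₁ := by rw [← hcoe, hg]; rfl
    obtain ⟨c, b, hc, hb, -⟩ := exists_eq_mul_add_of_deriv_eq_algebraMap ht₂ h2 ha g.2 hg'
    refine one_ne_zero (hC 1 (-c) b (by simp) (by simp [hc]) ?_).1
    linear_combination -hb
  rw [← adjoin_simple_adjoin_simple, mem_restrictScalars] at hu
  constructor
  · intro h
    obtain ⟨c, hc, rfl⟩ := exists_algebraMap_eq_of_deriv_eq_zero ht₁ h1' ha' hu h
    obtain ⟨d, -, hd⟩ := exists_algebraMap_eq_of_deriv_eq_zero ht₂ h2 ha c.2 h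
    exact ⟨d, hd⟩
  · intro h
    obtain ⟨c, g, hc, hg, -⟩ := exists_eq_mul_add_of_deriv_eq_algebraMap ht₁ h1' ha' hu
      (b := algebraMap K K⟮x₂⟯ f₁ * AdjoinSimple.gen K x₂ + algebraMap K K⟮x₂⟯ r) h
    have hc' : (c : L)′ = 0 := by rw [← hcoe, hc]; rfl
    obtain ⟨d, -, hd⟩ := exists_algebraMap_eq_of_deriv_eq_zero ht₂ h2 ha c.2 hc'
    refine deriv_ne_mul_add_of_mem_adjoin hC ht₂ h2 (r - d * f₁) g.2 ?_
    have hg' := congrArg (algebraMap K⟮x₂⟯ L) hg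
    have hd' : algebraMap K⟮x₂⟯ L c = algebraMap K L d := hd
    simp only [map_add, map_mul, ← deriv_algebraMap, hd', AdjoinSimple.algebraMap_gen,
      ← IsScalarTower.algebraMap_apply K K⟮x₂⟯ L] at hg'
    rw [map_sub, map_mul]
    change (algebraMap K⟮x₂⟯ L g)′ = _
    linear_combination hg'

end PrimitiveExtension


/-- Let `F` be a differential field of characteristic zero whose elements
`f₁, f₂` satisfy condition (C), let `r ∈ F`, and let `E = F(x₁, x₂, y)` with `x₁, x₂, y`
algebraically independent over `F` and `x₁′ = f₁`, `x₂′ = f₂`, `y′ = f₁·x₂ + r`.  Then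
every constant of `E` lies in the constants `C` of `F`; in particular there is no
`u ∈ F(x₁, x₂)` with `u′ = f₁·x₂ + r`. -/
theorem no_new_constants_heisenberg_generator
    (E : Type) [Field E] [CharZero E] (D : Derivation ℚ E E)
    (F : Subfield E) (hF : ∀ a ∈ F, D a ∈ F)
    (f₁ f₂ r : E) (hf₁ : f₁ ∈ F) (hf₂ : f₂ ∈ F) (hr : r ∈ F)
    (hcondC : ∀ c₁ c₂ g : E, c₁ ∈ F → D c₁ = 0 → c₂ ∈ F → D c₂ = 0 → g ∈ F →
      c₁ * f₁ + c₂ * f₂ = D g → c₁ = 0 ∧ c₂ = 0)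
    (x₁ x₂ y : E) (hind : AlgebraicIndependent F ![x₁, x₂, y])
    (h1 : D x₁ = f₁) (h2 : D x₂ = f₂) (h3 : D y = f₁ * x₂ + r)
    (hgen : Subfield.closure (↑F ∪ {x₁, x₂, y}) = ⊤) :
    (∀ c : E, D c = 0 → c ∈ F) ∧
      ¬ ∃ u ∈ Subfield.closure (↑F ∪ {x₁, x₂}), D u = f₁ * x₂ + r := by
  let : Differential E := ⟨D.restrictScalars ℤ⟩
  have hstable : ∀ a : F, ∃ b : F, algebraMap F E b = (algebraMap F E a)′ :=
    fun a ↦ ⟨⟨D a, hF a a.2⟩, rfl⟩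
  let := Differential.restrict hstable
  have := Differential.differentialAlgebra_restrict hstable
  have hcoe : ∀ a : F, ((a′ : F) : E) = D a := fun a ↦ (deriv_algebraMap a).symm
  have hC : ∀ c₁ c₂ g : F, c₁′ = 0 → c₂′ = 0 → c₁ * ⟨f₁, hf₁⟩ + c₂ * ⟨f₂, hf₂⟩ = g′ →
      c₁ = 0 ∧ c₂ = 0 := by
    intro c₁ c₂ g hc₁ hc₂ hg
    have := hcondC c₁ c₂ g c₁.2 (by rw [← hcoe, hc₁]; rfl) c₂.2 (by rw [← hcoe, hc₂]; rfl) g.2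
      (by rw [← hcoe, ← hg]; rfl)
    exact ⟨Subtype.ext this.1, Subtype.ext this.2⟩
  have ht₂ : Transcendental F x₂ := hind.transcendental 1
  have ht₁ : Transcendental F⟮x₂⟯ x₁ := by
    have := hind.transcendental_adjoin (s := {1}) (i := 0) (by simp)
    rw [Set.image_singleton] at this
    exact transcendental_adjoin_iff.2 this
  have hty : Transcendental F⟮x₂, x₁⟯ y := by
    have := hind.transcendental_adjoin (s := {1, 0}) (i := 2) (by simp)
    rw [Set.image_pair] at this
    exact transcendental_adjoin_iff.2 this
  have hpair := fun u (hu : u ∈ F⟮x₂, x₁⟯) ↦ constants_and_deriv_ne_of_mem_adjoin_pair (L := E)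
    hC ht₂ ht₁ h1 h2 ⟨r, hr⟩ hu
  have hmem : ∀ {S : Set E} {u : E}, u ∈ adjoin F S ↔ u ∈ Subfield.closure (↑F ∪ S) := by
    intro S u
    rw [← mem_toSubfield, adjoin_toSubfield]
    have : Set.range (algebraMap F E) = F := Subtype.range_coe
    rw [this]
  have hstable₂ : ∀ a : F⟮x₂, x₁⟯, ∃ b : F⟮x₂, x₁⟯,
      algebraMap F⟮x₂, x₁⟯ E b = (algebraMap F⟮x₂, x₁⟯ E a)′ := by
    refine fun a ↦ ⟨⟨_, deriv_mem_adjoin ?_ a.2⟩, rfl⟩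
    rintro _ (rfl | rfl)
    · exact h2 ▸ IntermediateField.algebraMap_mem _ (⟨f₂, hf₂⟩ : F)
    · exact h1 ▸ IntermediateField.algebraMap_mem _ (⟨f₁, hf₁⟩ : F)
  let := Differential.restrict hstable₂
  have := Differential.differentialAlgebra_restrict hstable₂
  constructor
  · intro c hc
    have hc' : c ∈ F⟮x₂, x₁⟯⟮y⟯ := by
      rw [← mem_restrictScalars F, adjoin_adjoin_left, hmem,
        show ({x₂, x₁} ∪ {y} : Set E) = {x₁, x₂, y} by ext; simp; tauto, hgen]
      trivial
    let ξ : F⟮x₂, x₁⟯ := ⟨x₂, subset_adjoin F _ (Set.mem_insert _ _)⟩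
    obtain ⟨d, -, rfl⟩ := exists_algebraMap_eq_of_deriv_eq_zero hty
      (a := algebraMap F F⟮x₂, x₁⟯ ⟨f₁, hf₁⟩ * ξ + algebraMap F F⟮x₂, x₁⟯ ⟨r, hr⟩)
      h3 (fun g hg ↦ (hpair g g.2).2
        ((deriv_algebraMap g).trans (congrArg (algebraMap F⟮x₂, x₁⟯ E) hg))) hc' hc
    obtain ⟨e, he⟩ := (hpair d d.2).1 hc
    rw [show algebraMap F⟮x₂, x₁⟯ E d = algebraMap F E e from he]
    exact e.2
  · rintro ⟨u, hu, h⟩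
    rw [Set.pair_comm, ← hmem] at hu
    exact (hpair u hu).2 h
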